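/- arXiv:cs/0612094 — 2 statements merged into one kernel-verified Lean document; each statement's English description precedes it below -/
import Mathlib

section
/- Let A be a commutative ℚ-algebra, δ a derivation of A that is locally nilpotent (for every f ∈ A there exists N with δ^{N+1} f = 0), and ρ ∈ A with δρ = 1. Define π : A → A by π(f) := ∑_{i=0}^{N} (1/i!)·(-ρ)^i·δ^i f for any N with δ^{N+1} f = 0 (the value is independent of the choice of such N). Then π is a ℚ-algebra homomorphism: π(f+g) = π(f)+π(g), π(fg) = π(f)·π(g), π(1) = 1; moreover π(ρ) = 0. -/
namespace Derivation

open Finset Polynomial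

section Iterate

variable {R A : Type*} [CommSemiring R] [CommSemiring A] [Algebra R A] (δ : Derivation R A A)

theorem iterate_apply_eq_zero_of_le {f : A} {m n : ℕ} (hmn : m ≤ n) (h : (⇑δ)^[m] f = 0) :
    (⇑δ)^[n] f = 0 := by
  obtain ⟨k, rfl⟩ := Nat.exists_eq_add_of_le' hmn
  rw [Function.iterate_add_apply, h, iterate_map_zero]

/-- The general Leibniz rule. -/
theorem iterate_apply_mul (f g : A) (n : ℕ) :
    (⇑δ)^[n] (f * g) =
      ∑ p ∈ antidiagonal n, n.choose p.1 • ((⇑δ)^[p.1] f * (⇑δ)^[p.2] g) := by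
  induction n with
  | zero => simp
  | succ n ih =>
    rw [sum_antidiagonal_choose_succ_nsmul (fun i j => (⇑δ)^[i] f * (⇑δ)^[j] g) n,
      Function.iterate_succ_apply', ih, map_sum, ← sum_add_distrib]
    refine sum_congr rfl fun p hp => ?_
    rw [← Nat.choose_symm_of_eq_add (mem_antidiagonal.mp hp).symm]
    simp only [map_nsmul, leibniz, smul_eq_mul, Function.iterate_succ_apply', ← smul_add]
    ring

end Iterate

variable {A : Type*} [CommRing A] [Algebra ℚ A] (δ : Derivation ℚ A A)

/-- The `i`-th term of the formal exponential `exp (s • δ)` applied to `f`. -/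
noncomputable def expTerm (s f : A) (i : ℕ) : A :=
  (1 / (i.factorial : ℚ)) • (s ^ i * (⇑δ)^[i] f)

theorem expTerm_add (s f g : A) (i : ℕ) :
    δ.expTerm s (f + g) i = δ.expTerm s f i + δ.expTerm s g i := by
  simp only [expTerm, iterate_map_add, mul_add, smul_add]

theorem expTerm_mul (s f g : A) (n : ℕ) :
    δ.expTerm s (f * g) n =
      ∑ p ∈ antidiagonal n, δ.expTerm s f p.1 * δ.expTerm s g p.2 := by
  simp only [expTerm, iterate_apply_mul, mul_sum, smul_sum]
  refine sum_congr rfl fun p hp => ?_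
  obtain rfl := mem_antidiagonal.mp hp
  have hc : (1 / ((p.1 + p.2).factorial : ℚ)) * ((p.1 + p.2).choose p.1 : ℚ) =
      (1 / (p.1.factorial : ℚ)) * (1 / (p.2.factorial : ℚ)) := by
    rw [Nat.cast_add_choose]
    field_simp
  rw [smul_mul_smul_comm, ← hc, mul_smul, Nat.cast_smul_eq_nsmul, mul_smul_comm, pow_add,
    mul_mul_mul_comm]

theorem expTerm_eq_zero {s f : A} {i : ℕ} (h : (⇑δ)^[i] f = 0) : δ.expTerm s f i = 0 := by
  simp [expTerm, h]

theorem exists_polynomial_coeff_eq_expTerm (s : A) {f : A} {N : ℕ} (h : (⇑δ)^[N] f = 0) :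
    ∃ p : A[X], (∀ i, p.coeff i = δ.expTerm s f i) ∧
      p.eval 1 = ∑ i ∈ range N, δ.expTerm s f i := by
  refine ⟨∑ i ∈ range N, monomial i (δ.expTerm s f i), fun i => ?_, by simp [eval_finsetSum]⟩
  simp only [finsetSum_coeff, coeff_monomial, sum_ite_eq', mem_range, ite_eq_left_iff, not_lt]
  exact fun hi => (δ.expTerm_eq_zero (δ.iterate_apply_eq_zero_of_le hi h)).symm

end Derivation

/-- For a locally nilpotent derivation `δ` with principal element `ρ` (`δρ = 1`),
the rectifying operator `π f = ∑_{i=0}^N (1/i!)·(-ρ)^i·δ^i f` (for any `N` with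
`δ^{N+1} f = 0`; the value does not depend on this choice) is a ℚ-algebra morphism
and `π ρ = 0`. -/
theorem rectifying_operator_is_ring_hom
    {A : Type*} [CommRing A] [Algebra ℚ A]
    (δ : Derivation ℚ A A)
    (hnil : ∀ f : A, ∃ N : ℕ, (⇑δ)^[N + 1] f = 0)
    (ρ : A) (hρ : δ ρ = 1)
    (π : A → A)
    (hπ : ∀ (f : A) (N : ℕ), (⇑δ)^[N + 1] f = 0 →
      π f = ∑ i ∈ Finset.range (N + 1),
        (1 / (i.factorial : ℚ)) • ((-ρ) ^ i * (⇑δ)^[i] f)) :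
    (∀ f g : A, π (f + g) = π f + π g) ∧
    (∀ f g : A, π (f * g) = π f * π g) ∧
    π 1 = 1 ∧
    π ρ = 0 := by
  have hpoly : ∀ f : A, ∃ p : Polynomial A,
      (∀ i, p.coeff i = δ.expTerm (-ρ) f i) ∧ p.eval 1 = π f := fun f => by
    obtain ⟨N, hN⟩ := hnil f
    obtain ⟨p, hp, hp1⟩ := δ.exists_polynomial_coeff_eq_expTerm (-ρ) hN
    exact ⟨p, hp, hp1.trans (hπ f N hN).symm⟩
  choose P hcoeff heval using hpoly
  refine ⟨fun f g => ?_, fun f g => ?_, ?_, ?_⟩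
  · have h : P (f + g) = P f + P g := by
      ext i
      simp only [Polynomial.coeff_add, hcoeff, Derivation.expTerm_add]
    rw [← heval, h, Polynomial.eval_add, heval, heval]
  · have h : P (f * g) = P f * P g := by
      ext i
      simp only [Polynomial.coeff_mul, hcoeff, Derivation.expTerm_mul]
    rw [← heval, h, Polynomial.eval_mul, heval, heval]
  · simp [hπ 1 0 (by simp)]
  · simp [hπ ρ 1 (by simp [hρ]), Finset.sum_range_succ, hρ]
end

section
/- Consider the polynomial ring ℝ[x, y, b] and the derivation δ determined by δ(x) = x², δ(y) = 1 − 2xy, δ(b) = x². Then: (i) δ(1 − x + x²y) = 0 and δ(b − x²y) = 0, so δ generates a one-parameter group of Lie point symmetries of the algebraic system {1 − x + x²y = 0, b − x²y = 0}; and (ii) δ(b)·(x·(x − b)) − b·δ(x·(x − b)) = (x·(x − b))², so that by the quotient rule the rational function ρ := b/(x(x − b)) satisfies δρ = 1, i.e. ρ is a principal element of this non-affine derivation. -/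
open MvPolynomial

/-- The non-affine derivation `δ` of `ℝ[x,y,b]` (variables indexed `0 = x`, `1 = y`,
`2 = b`) given by `δx = x²`, `δy = 1 − 2xy`, `δb = x²` annihilates the system
`{1 − x + x²y, b − x²y}`, and satisfies the identity
`δ(b)·(x(x−b)) − b·δ(x(x−b)) = (x(x−b))²`, so that by the quotient rule
`ρ := b/(x(x−b))` is a principal element of `δ`. -/
theorem nonaffine_symmetry_and_principal_element
    (δ : Derivation ℝ (MvPolynomial (Fin 3) ℝ) (MvPolynomial (Fin 3) ℝ))
    (hx : δ (X 0) = X 0 ^ 2)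
    (hy : δ (X 1) = 1 - 2 * X 0 * X 1)
    (hb : δ (X 2) = X 0 ^ 2) :
    δ (1 - X 0 + X 0 ^ 2 * X 1) = 0 ∧
    δ (X 2 - X 0 ^ 2 * X 1) = 0 ∧
    δ (X 2) * (X 0 * (X 0 - X 2)) - X 2 * δ (X 0 * (X 0 - X 2)) =
      (X 0 * (X 0 - X 2)) ^ 2 := by
  have hxy : δ (X 0 ^ 2 * X 1) = X 0 ^ 2 := by
    rw [pow_two, Derivation.leibniz, Derivation.leibniz, hx, hy]
    simp only [smul_eq_mul]
    ring
  refine ⟨?_, ?_, ?_⟩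
  · rw [map_add, map_sub, Derivation.map_one_eq_zero, hx, hxy]
    ring
  · rw [map_sub, hb, hxy, sub_self]
  · rw [Derivation.leibniz, map_sub, hx, hb]
    simp only [smul_eq_mul]
    ring
end
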